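/- arXiv:1411.7834 — 2 statements merged into one kernel-verified Lean document; each statement's English description precedes it below -/
import Mathlib

section
/- For every n ≥ 1 and every integer k ≥ 1, the number of LL_{k+1}S on [n] = {1,…,n} equals the number of k-coloured rooted labelled trees on [n] in which every inner vertex is a descent. -/
/-- A rooted plane `m`-ary tree whose nodes are labelled bijectively by the finite set
`V` of positive integers.  It is encoded by its root, a parent function and a
position function (positions are `0, …, m-1`, corresponding to child positions
`1, …, m`); `acyclic` guarantees that parent chains terminate at the root, and
`plane` that distinct children of a node occupy distinct positions.  The functions
are normalised to `0` outside the non-root vertices of `V`, so that the encoding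
is unique. -/
structure PlaneTree (m : ℕ) (V : Finset ℕ) where
  root : ℕ
  par : ℕ → ℕ
  pos : ℕ → ℕ
  root_mem : root ∈ V
  par_mem : ∀ v ∈ V, v ≠ root → par v ∈ V
  pos_lt : ∀ v ∈ V, v ≠ root → pos v < m
  acyclic : ∃ d : ℕ → ℕ, ∀ v ∈ V, v ≠ root → d (par v) < d v
  plane : ∀ u ∈ V, ∀ v ∈ V, u ≠ root → v ≠ root → par u = par v → pos u = pos v → u = v
  par_default : ∀ v, v ∉ V ∨ v = root → par v = 0
  pos_default : ∀ v, v ∉ V ∨ v = root → pos v = 0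

/-- `y` is the child of `x` in position `i` (`0`-based). -/
def PlaneTree.IsChildAt {m : ℕ} {V : Finset ℕ} (t : PlaneTree m V) (x i y : ℕ) : Prop :=
  y ∈ V ∧ y ≠ t.root ∧ t.par y = x ∧ t.pos y = i

/-- A local `m`-ary search tree: the child in position `1` (index `0`) is smaller than
its parent and the child in position `m` (index `m-1`) is larger than its parent. -/
def IsLS {m : ℕ} {V : Finset ℕ} (t : PlaneTree m V) : Prop :=
  (∀ y ∈ V, y ≠ t.root → t.pos y = 0 → y < t.par y) ∧
  (∀ y ∈ V, y ≠ t.root → t.pos y = m - 1 → t.par y < y)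

/-- A left local `m`-ary search tree: a local `m`-ary search tree whose root has no
child in position `m` (index `m-1`). -/
def IsLLS {m : ℕ} {V : Finset ℕ} (t : PlaneTree m V) : Prop :=
  IsLS t ∧ ¬ ∃ y, t.IsChildAt t.root (m - 1) y

/-- A right local `m`-ary search tree: a local `m`-ary search tree whose root has no
child in position `1` (index `0`). -/
def IsRLS {m : ℕ} {V : Finset ℕ} (t : PlaneTree m V) : Prop :=
  IsLS t ∧ ¬ ∃ y, t.IsChildAt t.root 0 y

/-- A semi-local `m`-ary search tree: for every node having at least one child in
positions `1, …, m-1` (indices `0, …, m-2`), the child occupying the smallest-indexed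
occupied such position is smaller than its parent, and the child in position `m`
(index `m-1`) is larger than its parent. -/
def IsSLS {m : ℕ} {V : Finset ℕ} (t : PlaneTree m V) : Prop :=
  (∀ y ∈ V, y ≠ t.root → t.pos y = m - 1 → t.par y < y) ∧
  (∀ y ∈ V, y ≠ t.root → t.pos y < m - 1 →
    (∀ z ∈ V, z ≠ t.root → t.par z = t.par y → t.pos z < m - 1 → t.pos y ≤ t.pos z) →
    y < t.par y)

/-- A left semi-local `m`-ary search tree: a semi-local `m`-ary search tree whose root
has no child in position `m` (index `m-1`). -/
def IsSLLS {m : ℕ} {V : Finset ℕ} (t : PlaneTree m V) : Prop :=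
  IsSLS t ∧ ¬ ∃ y, t.IsChildAt t.root (m - 1) y
/-- A `k`-coloured rooted labelled tree on the finite set `V`: a rooted tree with
vertex set `V` together with a colour in `{0, …, k-1}` (representing `{1, …, k}`)
assigned to each edge (recorded on the child endpoint).  The functions are
normalised to `0` outside the non-root vertices of `V`. -/
structure ColTree (k : ℕ) (V : Finset ℕ) where
  root : ℕ
  par : ℕ → ℕ
  col : ℕ → ℕ
  root_mem : root ∈ V
  par_mem : ∀ v ∈ V, v ≠ root → par v ∈ V
  col_lt : ∀ v ∈ V, v ≠ root → col v < k
  acyclic : ∃ d : ℕ → ℕ, ∀ v ∈ V, v ≠ root → d (par v) < d v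
  par_default : ∀ v, v ∉ V ∨ v = root → par v = 0
  col_default : ∀ v, v ∉ V ∨ v = root → col v = 0

/-- `y` is a child of `x` in a coloured rooted labelled tree. -/
def ColTree.IsChild {k : ℕ} {V : Finset ℕ} (t : ColTree k V) (x y : ℕ) : Prop :=
  y ∈ V ∧ y ≠ t.root ∧ t.par y = x

/-- An inner vertex `x` is a descent if it has no child of colour `1` (index `0`), or
its smallest child of colour `1` has label smaller than `x`. -/
def ColTree.IsDescent {k : ℕ} {V : Finset ℕ} (t : ColTree k V) (x : ℕ) : Prop :=
  (¬ ∃ y, t.IsChild x y ∧ t.col y = 0) ∨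
  (∃ y, t.IsChild x y ∧ t.col y = 0 ∧ (∀ z, t.IsChild x z → t.col z = 0 → y ≤ z) ∧ y < x)

/-- An inner vertex `x` is an S-descent if, letting `i` be the smallest colour
occurring among the children of `x`, the smallest child of colour `i` has label
smaller than `x`. -/
def ColTree.IsSDescent {k : ℕ} {V : Finset ℕ} (t : ColTree k V) (x : ℕ) : Prop :=
  ∃ y, t.IsChild x y ∧ (∀ z, t.IsChild x z → t.col y ≤ t.col z) ∧
    (∀ z, t.IsChild x z → t.col z = t.col y → y ≤ z) ∧ y < x

theorem PlaneTree.ext_data {m : ℕ} {V : Finset ℕ} {s t : PlaneTree m V}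
    (h1 : s.root = t.root) (h2 : s.par = t.par) (h3 : s.pos = t.pos) : s = t := by
  cases s; cases t; simp_all

theorem ColTree.ext_data {m : ℕ} {V : Finset ℕ} {s t : ColTree m V}
    (h1 : s.root = t.root) (h2 : s.par = t.par) (h3 : s.col = t.col) : s = t := by
  cases s; cases t; simp_all

/-- Follow last-position edges upwards. -/
def topf (k : ℕ) (par pos : ℕ → ℕ) (v : ℕ) : ℕ :=
  if _h : pos v = k ∧ par v < v then topf k par pos (par v) else v
termination_by v
decreasing_by exact _h.2

theorem topf_step {k : ℕ} {par pos : ℕ → ℕ} {v : ℕ} (h1 : pos v = k) (h2 : par v < v) :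
    topf k par pos v = topf k par pos (par v) := by
  rw [topf]; simp [h1, h2]

theorem topf_stop {k : ℕ} {par pos : ℕ → ℕ} {v : ℕ} (h1 : pos v ≠ k) :
    topf k par pos v = v := by
  rw [topf]; simp [h1]

theorem topf_le (k : ℕ) (par pos : ℕ → ℕ) (v : ℕ) : topf k par pos v ≤ v := by
  induction v using Nat.strong_induction_on with
  | _ v ih =>
    rw [topf]
    split_ifs with h
    · exact (ih _ h.2).trans h.2.le
    · exact le_rfl

section plane
variable {k : ℕ} {V : Finset ℕ}

theorem PlaneTree.pos_k (hk : 1 ≤ k) {p : PlaneTree (k + 1) V} (hp : IsLLS p) {v : ℕ}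
    (h : p.pos v = k) :
    v ∈ V ∧ v ≠ p.root ∧ p.par v < v ∧ p.par v ∈ V ∧ p.par v ≠ p.root := by
  have h0 : ¬ (v ∉ V ∨ v = p.root) := fun h' => by
    have := p.pos_default v h'
    omega
  push Not at h0
  refine ⟨h0.1, h0.2, hp.1.2 v h0.1 h0.2 (by simpa using h), p.par_mem v h0.1 h0.2, fun hr => ?_⟩
  exact hp.2 ⟨v, h0.1, h0.2, hr, by simpa using h⟩

theorem PlaneTree.top_spec (hk : 1 ≤ k) {p : PlaneTree (k + 1) V} (hp : IsLLS p)
    (d : ℕ → ℕ) (hd : ∀ v ∈ V, v ≠ p.root → d (p.par v) < d v) (v : ℕ)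
    (hv : v ∈ V) (hr : v ≠ p.root) :
    topf k p.par p.pos v ∈ V ∧ topf k p.par p.pos v ≠ p.root ∧
      p.pos (topf k p.par p.pos v) < k ∧ d (topf k p.par p.pos v) ≤ d v := by
  induction v using Nat.strong_induction_on with
  | _ v ih =>
    by_cases h : p.pos v = k
    · obtain ⟨_, _, h1, h2, h3⟩ := PlaneTree.pos_k hk hp h
      rw [topf_step h h1]
      obtain ⟨a, b, c, e⟩ := ih _ h1 h2 h3
      exact ⟨a, b, c, e.trans (hd v hv hr).le⟩
    · rw [topf_stop h]
      have := p.pos_lt v hv hr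
      exact ⟨hv, hr, by omega, le_rfl⟩

theorem PlaneTree.chain (hk : 1 ≤ k) {p : PlaneTree (k + 1) V} (hp : IsLLS p) (w : ℕ) :
    ∀ v, p.pos v = k → topf k p.par p.pos w = topf k p.par p.pos v →
      p.par v < w → w < v → False := by
  induction w using Nat.strong_induction_on with
  | _ w ih =>
    intro v hv ht h1 h2
    obtain ⟨a1, a2, a3, a4, a5⟩ := PlaneTree.pos_k hk hp hv
    have htv := topf_step hv a3
    have hw : p.pos w = k := by
      by_contra hw
      have := topf_stop (par := p.par) hw
      have := topf_le k p.par p.pos (p.par v)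
      omega
    obtain ⟨b1, b2, b3, b4, b5⟩ := PlaneTree.pos_k hk hp hw
    have htw := topf_step hw b3
    rcases lt_trichotomy (p.par w) (p.par v) with h | h | h
    · exact ih (p.par v) h1 w hw (by omega) h h1
    · have := p.plane w b1 v a1 b2 a2 h (by omega)
      omega
    · exact ih (p.par w) b3 v hv (by omega) h (by omega)

/-- From plane trees to coloured trees. -/
def toCol (hk : 1 ≤ k) (p : PlaneTree (k + 1) V) (hp : IsLLS p) : ColTree k V where
  root := p.root
  par v := p.par (topf k p.par p.pos v)
  col v := p.pos (topf k p.par p.pos v)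
  root_mem := p.root_mem
  par_mem v hv hr := by
    obtain ⟨d, hd⟩ := p.acyclic
    obtain ⟨a, b, c, e⟩ := PlaneTree.top_spec hk hp d hd v hv hr
    exact p.par_mem _ a b
  col_lt v hv hr := by
    obtain ⟨d, hd⟩ := p.acyclic
    obtain ⟨a, b, c, e⟩ := PlaneTree.top_spec hk hp d hd v hv hr
    exact c
  acyclic := by
    obtain ⟨d, hd⟩ := p.acyclic
    refine ⟨d, fun v hv hr => ?_⟩
    obtain ⟨a, b, c, e⟩ := PlaneTree.top_spec hk hp d hd v hv hr
    exact (hd _ a b).trans_le e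
  par_default v h := by
    have h0 := p.pos_default v h
    rw [topf_stop (by omega)]
    exact p.par_default v h
  col_default v h := by
    have h0 := p.pos_default v h
    rw [topf_stop (by omega)]
    exact h0

theorem PlaneTree.class_iff (hk : 1 ≤ k) {p : PlaneTree (k + 1) V} (hp : IsLLS p) {u v : ℕ}
    (hu : u ∈ V) (hur : u ≠ p.root) (hv : v ∈ V) (hvr : v ≠ p.root)
    (h1 : p.par (topf k p.par p.pos u) = p.par (topf k p.par p.pos v))
    (h2 : p.pos (topf k p.par p.pos u) = p.pos (topf k p.par p.pos v)) :
    topf k p.par p.pos u = topf k p.par p.pos v := by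
  obtain ⟨d, hd⟩ := p.acyclic
  obtain ⟨a, b, c, e⟩ := PlaneTree.top_spec hk hp d hd v hv hvr
  obtain ⟨a', b', c', e'⟩ := PlaneTree.top_spec hk hp d hd u hu hur
  exact p.plane _ a' _ a b' b h1 h2

theorem toCol_descent (hk : 1 ≤ k) (p : PlaneTree (k + 1) V) (hp : IsLLS p) :
    ∀ x ∈ V, (∃ y, (toCol hk p hp).IsChild x y) → (toCol hk p hp).IsDescent x := by
  intro x hx _
  by_cases h : ∃ y, (toCol hk p hp).IsChild x y ∧ (toCol hk p hp).col y = 0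
  · right
    obtain ⟨y, ⟨hy, hyr, hyx⟩, hc⟩ := h
    change p.par (topf k p.par p.pos y) = x at hyx
    change p.pos (topf k p.par p.pos y) = 0 at hc
    obtain ⟨d, hd⟩ := p.acyclic
    obtain ⟨a, b, c, e⟩ := PlaneTree.top_spec hk hp d hd y hy hyr
    have hs : topf k p.par p.pos (topf k p.par p.pos y) = topf k p.par p.pos y :=
      topf_stop (by omega)
    refine ⟨topf k p.par p.pos y, ⟨a, b, ?_⟩, ?_, ?_, ?_⟩
    · change p.par (topf k p.par p.pos (topf k p.par p.pos y)) = x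
      rw [hs, hyx]
    · change p.pos (topf k p.par p.pos (topf k p.par p.pos y)) = 0
      rw [hs, hc]
    · rintro z ⟨hz, hzr, hzx⟩ hzc
      change p.par (topf k p.par p.pos z) = x at hzx
      change p.pos (topf k p.par p.pos z) = 0 at hzc
      rw [PlaneTree.class_iff hk hp hy hyr hz hzr (by omega) (by omega)]
      exact topf_le _ _ _ _
    · have := hp.1.1 _ a b hc
      omega
  · exact Or.inl h

/-- Smaller siblings of the same colour. -/
def ColTree.S (c : ColTree k V) (v : ℕ) : Finset ℕ :=
  V.filter fun u => u ≠ c.root ∧ c.par u = c.par v ∧ c.col u = c.col v ∧ u < v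

theorem ColTree.mem_S {c : ColTree k V} {u v : ℕ} :
    u ∈ c.S v ↔ u ∈ V ∧ u ≠ c.root ∧ c.par u = c.par v ∧ c.col u = c.col v ∧ u < v := by
  simp [ColTree.S]

theorem ColTree.pred_mem {c : ColTree k V} {v : ℕ} (h : c.S v ≠ ∅) :
    (c.S v).sup id ∈ c.S v := by
  obtain ⟨u, hu, hs⟩ := Finset.exists_mem_eq_sup (c.S v) (Finset.nonempty_iff_ne_empty.2 h) id
  rw [hs]; exact hu

theorem ColTree.le_pred {c : ColTree k V} {u v : ℕ} (h : u ∈ c.S v) :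
    u ≤ (c.S v).sup id := Finset.le_sup (f := id) h

/-- Parent function of the plane tree. -/
def ColTree.gpar (c : ColTree k V) (v : ℕ) : ℕ :=
  if v ∈ V ∧ v ≠ c.root then (if c.S v = ∅ then c.par v else (c.S v).sup id) else 0

/-- Position function of the plane tree. -/
def ColTree.gpos (c : ColTree k V) (v : ℕ) : ℕ :=
  if v ∈ V ∧ v ≠ c.root then (if c.S v = ∅ then c.col v else k) else 0

theorem ColTree.g_cases (c : ColTree k V) {v : ℕ} (hv : v ∈ V) (hr : v ≠ c.root) :
    (c.S v = ∅ ∧ c.gpar v = c.par v ∧ c.gpos v = c.col v ∧ c.gpos v < k) ∨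
    (c.S v ≠ ∅ ∧ c.gpar v ∈ c.S v ∧ c.gpos v = k ∧ ∀ u ∈ c.S v, u ≤ c.gpar v) := by
  by_cases h : c.S v = ∅
  · left
    have := c.col_lt v hv hr
    simp [ColTree.gpar, ColTree.gpos, hv, hr, h, this]
  · right
    have h1 : c.gpar v = (c.S v).sup id := by simp [ColTree.gpar, hv, hr, h]
    rw [h1]
    refine ⟨h, ColTree.pred_mem h, by simp [ColTree.gpos, hv, hr, h], fun u hu => ColTree.le_pred hu⟩

/-- From coloured trees to plane trees. -/
def toPlane (c : ColTree k V) : PlaneTree (k + 1) V where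
  root := c.root
  par := c.gpar
  pos := c.gpos
  root_mem := c.root_mem
  par_mem v hv hr := by
    rcases c.g_cases hv hr with ⟨h1, h2, h3, h4⟩ | ⟨h1, h2, h3, h4⟩
    · rw [h2]; exact c.par_mem v hv hr
    · exact (ColTree.mem_S.1 h2).1
  pos_lt v hv hr := by
    rcases c.g_cases hv hr with ⟨h1, h2, h3, h4⟩ | ⟨h1, h2, h3, h4⟩ <;> omega
  acyclic := by
    obtain ⟨d, hd⟩ := c.acyclic
    refine ⟨fun v => if v = c.root then 0 else (d (c.par v) + 1) * (V.sup id + 1) + v,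
      fun v hv hr => ?_⟩
    simp only [if_neg hr]
    rcases c.g_cases hv hr with ⟨h1, h2, h3, h4⟩ | ⟨h1, h2, h3, h4⟩
    · rw [h2]
      split_ifs with h
      · positivity
      · have e1 := hd _ (c.par_mem v hv hr) h
        have e2 : c.par v ≤ V.sup id := Finset.le_sup (f := id) (c.par_mem v hv hr)
        have e3 : (d (c.par (c.par v)) + 1) * (V.sup id + 1) ≤ d (c.par v) * (V.sup id + 1) :=
          Nat.mul_le_mul_right _ e1
        rw [Nat.add_mul (d (c.par v)) 1]
        omega
    · obtain ⟨g1, g2, g3, g4, g5⟩ := ColTree.mem_S.1 h2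
      rw [if_neg g2, g3]
      omega
  plane u hu v hv hur hvr hpar hpos := by
    rcases c.g_cases hu hur with ⟨h1, h2, h3, h4⟩ | ⟨h1, h2, h3, h4⟩ <;>
    rcases c.g_cases hv hvr with ⟨g1, g2, g3, g4⟩ | ⟨g1, g2, g3, g4⟩
    · rcases lt_trichotomy u v with h | h | h
      · have : u ∈ c.S v := ColTree.mem_S.2 ⟨hu, hur, by omega, by omega, h⟩
        simp [g1] at this
      · exact h
      · have : v ∈ c.S u := ColTree.mem_S.2 ⟨hv, hvr, by omega, by omega, h⟩
        simp [h1] at this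
    · omega
    · omega
    · obtain ⟨a1, a2, a3, a4, a5⟩ := ColTree.mem_S.1 h2
      obtain ⟨b1, b2, b3, b4, b5⟩ := ColTree.mem_S.1 g2
      rw [← hpar] at b3 b4
      rcases lt_trichotomy u v with h | h | h
      · have := g4 u (ColTree.mem_S.2 ⟨hu, hur, by omega, by omega, h⟩)
        omega
      · exact h
      · have := h4 v (ColTree.mem_S.2 ⟨hv, hvr, by omega, by omega, h⟩)
        omega
  par_default v h := by
    have : ¬ (v ∈ V ∧ v ≠ c.root) := by tauto
    simp [ColTree.gpar, this]
  pos_default v h := by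
    have : ¬ (v ∈ V ∧ v ≠ c.root) := by tauto
    simp [ColTree.gpos, this]

theorem toPlane_LLS (hk : 1 ≤ k) (c : ColTree k V)
    (hc : ∀ x ∈ V, (∃ y, c.IsChild x y) → c.IsDescent x) : IsLLS (toPlane c) := by
  refine ⟨⟨fun y hy hr h0 => ?_, fun y hy hr h0 => ?_⟩, ?_⟩
  · change c.gpos y = 0 at h0
    change y < c.gpar y
    change y ≠ c.root at hr
    rcases c.g_cases hy hr with ⟨h1, h2, h3, h4⟩ | ⟨h1, h2, h3, h4⟩
    · rw [h2]
      rcases hc (c.par y) (c.par_mem y hy hr) ⟨y, hy, hr, rfl⟩ with h | ⟨z, ⟨z1, z2, z3⟩, z4, z5, z6⟩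
      · exact absurd ⟨y, ⟨hy, hr, rfl⟩, by omega⟩ h
      · have : ¬ z < y := fun h => by
          have : z ∈ c.S y := ColTree.mem_S.2 ⟨z1, z2, z3, by omega, h⟩
          simp [h1] at this
        omega
    · omega
  · change c.gpos y = k at h0
    change c.gpar y < y
    change y ≠ c.root at hr
    rcases c.g_cases hy hr with ⟨h1, h2, h3, h4⟩ | ⟨h1, h2, h3, h4⟩
    · omega
    · exact (ColTree.mem_S.1 h2).2.2.2.2
  · rintro ⟨y, hy, hr, hp, h0⟩
    change c.gpos y = k at h0
    change c.gpar y = c.root at hp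
    change y ≠ c.root at hr
    rcases c.g_cases hy hr with ⟨h1, h2, h3, h4⟩ | ⟨h1, h2, h3, h4⟩
    · omega
    · exact (ColTree.mem_S.1 h2).2.1 hp

theorem ColTree.top_g (c : ColTree k V) (v : ℕ) (hv : v ∈ V) (hr : v ≠ c.root) :
    c.gpar (topf k c.gpar c.gpos v) = c.par v ∧ c.gpos (topf k c.gpar c.gpos v) = c.col v := by
  induction v using Nat.strong_induction_on with
  | _ v ih =>
    rcases c.g_cases hv hr with ⟨h1, h2, h3, h4⟩ | ⟨h1, h2, h3, h4⟩
    · rw [topf_stop (by omega)]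
      exact ⟨h2, h3⟩
    · obtain ⟨a1, a2, a3, a4, a5⟩ := ColTree.mem_S.1 h2
      rw [topf_step h3 a5, ← a3, ← a4]
      exact ih _ a5 a1 a2

theorem toCol_toPlane (hk : 1 ≤ k) (c : ColTree k V) (h : IsLLS (toPlane c)) :
    toCol hk (toPlane c) h = c := by
  refine ColTree.ext_data rfl (funext fun v => ?_) (funext fun v => ?_)
  · by_cases hv : v ∉ V ∨ v = c.root
    · rw [c.par_default v hv]
      exact (toCol hk (toPlane c) h).par_default v hv
    · push Not at hv
      exact (c.top_g v hv.1 hv.2).1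
  · by_cases hv : v ∉ V ∨ v = c.root
    · rw [c.col_default v hv]
      exact (toCol hk (toPlane c) h).col_default v hv
    · push Not at hv
      exact (c.top_g v hv.1 hv.2).2

theorem g_toCol (hk : 1 ≤ k) (p : PlaneTree (k + 1) V) (hp : IsLLS p) (v : ℕ)
    (hv : v ∈ V) (hr : v ≠ p.root) :
    (toCol hk p hp).gpar v = p.par v ∧ (toCol hk p hp).gpos v = p.pos v := by
  have key : ∀ u, u ∈ (toCol hk p hp).S v ↔
      u ∈ V ∧ u ≠ p.root ∧ topf k p.par p.pos u = topf k p.par p.pos v ∧ u < v := by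
    intro u
    rw [ColTree.mem_S]
    constructor
    · rintro ⟨a, b, c, d, e⟩
      exact ⟨a, b, PlaneTree.class_iff hk hp a b hv hr c d, e⟩
    · rintro ⟨a, b, c, e⟩
      exact ⟨a, b, congrArg p.par c, congrArg p.pos c, e⟩
  have hpar : (toCol hk p hp).par v = p.par (topf k p.par p.pos v) := rfl
  have hcol : (toCol hk p hp).col v = p.pos (topf k p.par p.pos v) := rfl
  by_cases h : p.pos v = k
  · obtain ⟨_, _, b3, b4, b5⟩ := PlaneTree.pos_k hk hp h
    have hm : p.par v ∈ (toCol hk p hp).S v := (key _).2 ⟨b4, b5, (topf_step h b3).symm, b3⟩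
    rcases (toCol hk p hp).g_cases hv hr with ⟨h1, h2, h3, h4⟩ | ⟨h1, h2, h3, h4⟩
    · simp [h1] at hm
    · refine ⟨?_, by omega⟩
      have h5 := h4 _ hm
      obtain ⟨_, _, e3, e4⟩ := (key _).1 h2
      by_contra hne
      exact PlaneTree.chain hk hp _ v h e3 (by omega) e4
  · have ht := topf_stop (par := p.par) h
    rcases (toCol hk p hp).g_cases hv hr with ⟨h1, h2, h3, h4⟩ | ⟨h1, h2, h3, h4⟩
    · rw [h2, h3, hpar, hcol, ht]
      exact ⟨rfl, rfl⟩
    · obtain ⟨_, _, e3, e4⟩ := (key _).1 h2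
      have := topf_le k p.par p.pos ((toCol hk p hp).gpar v)
      omega

theorem toPlane_toCol (hk : 1 ≤ k) (p : PlaneTree (k + 1) V) (hp : IsLLS p) :
    toPlane (toCol hk p hp) = p := by
  refine PlaneTree.ext_data rfl (funext fun v => ?_) (funext fun v => ?_)
  · by_cases hv : v ∉ V ∨ v = p.root
    · rw [p.par_default v hv]
      exact (toPlane (toCol hk p hp)).par_default v hv
    · push Not at hv
      exact (g_toCol hk p hp v hv.1 hv.2).1
  · by_cases hv : v ∉ V ∨ v = p.root
    · rw [p.pos_default v hv]
      exact (toPlane (toCol hk p hp)).pos_default v hv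
    · push Not at hv
      exact (g_toCol hk p hp v hv.1 hv.2).2

end plane

/-- For every `n ≥ 1` and every integer `k ≥ 1`, the number of `LL_{k+1}S` on `[n]`
equals the number of `k`-coloured rooted labelled trees on `[n]` in which every
inner vertex is a descent. -/
theorem llks_card_eq_descent_trees (n : ℕ) (hn : 1 ≤ n) (k : ℕ) (hk : 1 ≤ k) :
    Nat.card {t : PlaneTree (k + 1) (Finset.Icc 1 n) // IsLLS t} =
      Nat.card {t : ColTree k (Finset.Icc 1 n) //
        ∀ x ∈ Finset.Icc 1 n, (∃ y, t.IsChild x y) → t.IsDescent x} := by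
  exact Nat.card_congr
    { toFun := fun t => ⟨toCol hk t.1 t.2, toCol_descent hk t.1 t.2⟩
      invFun := fun c => ⟨toPlane c.1, toPlane_LLS hk c.1 c.2⟩
      left_inv := fun t => Subtype.ext (toPlane_toCol hk t.1 t.2)
      right_inv := fun c => Subtype.ext (toCol_toPlane hk c.1 (toPlane_LLS hk c.1 c.2)) }
end

section
/- For every n ≥ 1 and every integer k ≥ 1, the number of SLL_{k+1}S on [n] = {1,…,n} equals the number of k-coloured rooted labelled trees on [n] in which every inner vertex is an S-descent. -/
section Aux

theorem PlaneTree.eq_of {m : ℕ} {V : Finset ℕ} (s t : PlaneTree m V) (h1 : s.root = t.root)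
    (h2 : s.par = t.par) (h3 : s.pos = t.pos) : s = t := by
  cases s; cases t; simp_all

theorem ColTree.eq_of {m : ℕ} {V : Finset ℕ} (s t : ColTree m V) (h1 : s.root = t.root)
    (h2 : s.par = t.par) (h3 : s.col = t.col) : s = t := by
  cases s; cases t; simp_all

open Classical in
/-- Top of the chain of edges in the last position ending at `v`. -/
noncomputable def ptop {m : ℕ} {V : Finset ℕ} (t : PlaneTree m V) (v : ℕ) : ℕ :=
  if _h : v ∈ V ∧ v ≠ t.root ∧ t.pos v = m - 1 ∧ t.par v < v then ptop t (t.par v) else v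
termination_by v
decreasing_by exact _h.2.2.2

open Classical in
/-- Smaller siblings of the same colour. -/
noncomputable def sibs {k : ℕ} {V : Finset ℕ} (t : ColTree k V) (v : ℕ) : Finset ℕ :=
  V.filter (fun u => u ≠ t.root ∧ t.par u = t.par v ∧ t.col u = t.col v ∧ u < v)

theorem mem_sibs {k : ℕ} {V : Finset ℕ} (t : ColTree k V) (u v : ℕ) :
    u ∈ sibs t v ↔ u ∈ V ∧ u ≠ t.root ∧ t.par u = t.par v ∧ t.col u = t.col v ∧ u < v := by
  simp [sibs]

/-- The largest smaller sibling of the same colour. -/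
noncomputable def prevSib {k : ℕ} {V : Finset ℕ} (t : ColTree k V) (v : ℕ) : ℕ :=
  (sibs t v).sup id

theorem prevSib_mem {k : ℕ} {V : Finset ℕ} (t : ColTree k V) (v : ℕ) (h : (sibs t v).Nonempty) :
    prevSib t v ∈ sibs t v := by
  obtain ⟨i, hi, e⟩ := Finset.exists_mem_eq_sup (sibs t v) h id
  unfold prevSib
  rw [e]; exact hi

theorem le_prevSib {k : ℕ} {V : Finset ℕ} (t : ColTree k V) (u v : ℕ) (h : u ∈ sibs t v) :
    u ≤ prevSib t v := Finset.le_sup (f := id) h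

open Classical in
noncomputable def bpar {k : ℕ} {V : Finset ℕ} (t : ColTree k V) (v : ℕ) : ℕ :=
  if v ∈ V ∧ v ≠ t.root then (if (sibs t v).Nonempty then prevSib t v else t.par v) else 0

open Classical in
noncomputable def bpos {k : ℕ} {V : Finset ℕ} (t : ColTree k V) (v : ℕ) : ℕ :=
  if v ∈ V ∧ v ≠ t.root then (if (sibs t v).Nonempty then k else t.col v) else 0

theorem b_cases {k : ℕ} {V : Finset ℕ} (t : ColTree k V) (v : ℕ) (hv : v ∈ V) (hr : v ≠ t.root) :
    (bpos t v = k ∧ bpar t v ∈ V ∧ bpar t v ≠ t.root ∧ t.par (bpar t v) = t.par v ∧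
      t.col (bpar t v) = t.col v ∧ bpar t v < v ∧
      ∀ u ∈ V, u ≠ t.root → t.par u = t.par v → t.col u = t.col v → u < v → u ≤ bpar t v) ∨
    (bpos t v < k ∧ bpos t v = t.col v ∧ bpar t v = t.par v ∧
      ∀ u ∈ V, u ≠ t.root → t.par u = t.par v → t.col u = t.col v → v ≤ u) := by
  by_cases h : (sibs t v).Nonempty
  · left
    have e1 : bpar t v = prevSib t v := by simp [bpar, hv, hr, h]
    have e2 : bpos t v = k := by simp [bpos, hv, hr, h]
    have hm := prevSib_mem t v h
    rw [mem_sibs] at hm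
    rw [e1]
    refine ⟨e2, hm.1, hm.2.1, hm.2.2.1, hm.2.2.2.1, hm.2.2.2.2, ?_⟩
    intro u a b c d e
    exact le_prevSib t u v ((mem_sibs t u v).2 ⟨a, b, c, d, e⟩)
  · right
    have e1 : bpar t v = t.par v := by simp [bpar, hv, hr, h]
    have e2 : bpos t v = t.col v := by simp [bpos, hv, hr, h]
    refine ⟨e2 ▸ t.col_lt v hv hr, e2, e1, ?_⟩
    intro u a b c d
    by_contra hc
    exact h ⟨u, (mem_sibs t u v).2 ⟨a, b, c, d, by omega⟩⟩

open Classical in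
noncomputable def back {k : ℕ} {V : Finset ℕ} (t : ColTree k V) : PlaneTree (k + 1) V where
  root := t.root
  par := bpar t
  pos := bpos t
  root_mem := t.root_mem
  par_mem := by
    intro v hv hr
    rcases b_cases t v hv hr with h | h
    · exact h.2.1
    · rw [h.2.2.1]; exact t.par_mem v hv hr
  pos_lt := by
    intro v hv hr
    rcases b_cases t v hv hr with h | h <;> omega
  acyclic := by
    obtain ⟨d, hd⟩ := t.acyclic
    let e : ℕ → ℕ := fun v => if v = t.root then 0 else d (t.par v) + 1
    refine ⟨fun v => e v * (V.sup id + 1) + v, ?_⟩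
    intro v hv hr
    have ev : e v = d (t.par v) + 1 := by simp [e, hr]
    rcases b_cases t v hv hr with h | h
    · have : e (bpar t v) = e v := by simp [e, hr, h.2.2.1, h.2.2.2.1]
      simp only [this]
      have := h.2.2.2.2.2.1
      omega
    · have hlt : e (t.par v) < e v := by
        by_cases hp : t.par v = t.root
        · rw [ev]; simp [e, hp]
        · rw [ev]
          have := hd (t.par v) (t.par_mem v hv hr) hp
          simp only [e, hp, if_false]; omega
      have hle : t.par v ≤ V.sup id := Finset.le_sup (f := id) (t.par_mem v hv hr)
      have hm : (e (t.par v) + 1) * (V.sup id + 1) ≤ e v * (V.sup id + 1) :=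
        Nat.mul_le_mul_right _ hlt
      simp only [h.2.2.1]
      rw [Nat.add_mul] at hm
      omega
  plane := by
    intro u hu v hv ur vr hp hq
    rcases b_cases t u hu ur with h | h <;> rcases b_cases t v hv vr with g | g
    · obtain ⟨h1, h2, h3, h4, h5, h6, h7⟩ := h
      obtain ⟨g1, g2, g3, g4, g5, g6, g7⟩ := g
      have a : t.par u = t.par v := by rw [← h4, ← g4, hp]
      have b : t.col u = t.col v := by rw [← h5, ← g5, hp]
      rcases lt_trichotomy u v with l | l | l
      · have := g7 u hu ur a b l; omega
      · exact l
      · have := h7 v hv vr a.symm b.symm l; omega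
    · omega
    · omega
    · obtain ⟨h1, h2, h3, h4⟩ := h
      obtain ⟨g1, g2, g3, g4⟩ := g
      have a : t.par u = t.par v := by rw [← h3, ← g3, hp]
      have b : t.col u = t.col v := by rw [← h2, ← g2, hq]
      exact le_antisymm (h4 v hv vr a.symm b.symm) (g4 u hu ur a b)
  par_default := by
    intro v hv
    have : ¬ (v ∈ V ∧ v ≠ t.root) := by tauto
    simp only [bpar, this, if_false]
  pos_default := by
    intro v hv
    have : ¬ (v ∈ V ∧ v ≠ t.root) := by tauto
    simp only [bpos, this, if_false]

theorem back_slls {k : ℕ} {V : Finset ℕ} (t : ColTree k V)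
    (ht : ∀ x ∈ V, (∃ y, t.IsChild x y) → t.IsSDescent x) : IsSLLS (back t) := by
  refine ⟨⟨?_, ?_⟩, ?_⟩
  · intro y hy hr hp
    change bpos t y = k at hp
    change bpar t y < y
    rcases b_cases t y hy hr with h | h
    · exact h.2.2.2.2.2.1
    · omega
  · intro y hy hr hp hmin
    change bpos t y < k at hp
    change y < bpar t y
    rcases b_cases t y hy hr with h | h
    · omega
    · obtain ⟨h1, h2, h3, h4⟩ := h
      obtain ⟨z, ⟨z1, z2, z3⟩, c1, c2, c3⟩ := ht (t.par y) (t.par_mem y hy hr) ⟨y, hy, hr, rfl⟩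
      rcases b_cases t z z1 z2 with g | g
      · have := c2 (bpar t z) ⟨g.2.1, g.2.2.1, g.2.2.2.1.trans z3⟩ g.2.2.2.2.1
        have := g.2.2.2.2.2.1
        omega
      · obtain ⟨g1, g2, g3, g4⟩ := g
        have a : bpos t y ≤ bpos t z := hmin z z1 z2 (by
          change bpar t z = bpar t y
          rw [g3, h3, z3]) g1
        have b := c1 y ⟨hy, hr, rfl⟩
        have := h4 z z1 z2 z3 (by omega)
        omega
  · rintro ⟨y, hy, hr, hp, hq⟩
    change bpar t y = t.root at hp
    change bpos t y = k at hq
    rcases b_cases t y hy hr with h | h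
    · exact h.2.2.1 hp
    · omega

section fwd
variable {k : ℕ} {V : Finset ℕ} (t : PlaneTree (k + 1) V) (ht : IsSLLS t)

theorem ptop_idem_of (v : ℕ) (h : t.pos v ≠ k) : ptop t v = v := by
  rw [ptop, dif_neg]
  simp [h]

theorem ptop_step (ht : IsSLLS t) (v : ℕ) (hv : v ∈ V) (hr : v ≠ t.root) (h : t.pos v = k) :
    ptop t v = ptop t (t.par v) ∧ t.par v < v ∧ t.par v ∈ V ∧ t.par v ≠ t.root := by
  have hlt := ht.1.1 v hv hr h
  refine ⟨?_, hlt, t.par_mem v hv hr, ?_⟩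
  · rw [ptop, dif_pos ⟨hv, hr, h, hlt⟩]
  · intro e
    exact ht.2 ⟨v, hv, hr, e, h⟩

theorem ptop_spec (ht : IsSLLS t) (d : ℕ → ℕ)
    (hd : ∀ v ∈ V, v ≠ t.root → d (t.par v) < d v) (v : ℕ) (hv : v ∈ V) (hr : v ≠ t.root) :
    ptop t v ∈ V ∧ ptop t v ≠ t.root ∧ t.pos (ptop t v) < k ∧ ptop t v ≤ v ∧
      d (ptop t v) ≤ d v := by
  induction v using Nat.strong_induction_on with
  | _ v ih =>
    by_cases h : t.pos v = k
    · obtain ⟨a, b, c, e⟩ := ptop_step t ht v hv hr h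
      have := ih _ b c e
      have := hd v hv hr
      rw [a]
      refine ⟨?_, ?_, ?_, ?_, ?_⟩ <;> first | tauto | omega
    · rw [ptop_idem_of t v h]
      have := t.pos_lt v hv hr
      exact ⟨hv, hr, by omega, le_rfl, le_rfl⟩

theorem ptop_spec' (ht : IsSLLS t) (v : ℕ) (hv : v ∈ V) (hr : v ≠ t.root) :
    ptop t v ∈ V ∧ ptop t v ≠ t.root ∧ t.pos (ptop t v) < k ∧ ptop t v ≤ v := by
  obtain ⟨d, hd⟩ := t.acyclic
  have := ptop_spec t ht d hd v hv hr
  tauto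

theorem chain_lemma (ht : IsSLLS t) (N : ℕ) : ∀ u v : ℕ, u + v ≤ N → u ∈ V → u ≠ t.root → v ∈ V →
    v ≠ t.root → ptop t u = ptop t v → u < v → t.pos v = k ∧ u ≤ t.par v := by
  induction N with
  | zero => intro u v h _ _ _ _ _ h'; omega
  | succ N ih =>
    intro u v hN hu ur hv vr huv hlt
    have hk : t.pos v = k := by
      by_contra h
      have := (ptop_spec' t ht u hu ur).2.2.2
      rw [huv, ptop_idem_of t v h] at this
      omega
    refine ⟨hk, ?_⟩
    by_contra hc
    obtain ⟨a, b, c, e⟩ := ptop_step t ht v hv vr hk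
    obtain ⟨f, g⟩ := ih (t.par v) u (by omega) c e hu ur (by rw [← a, huv]) (by omega)
    obtain ⟨a', b', c', e'⟩ := ptop_step t ht u hu ur f
    have hne : t.par u ≠ t.par v := fun h => by
      have := t.plane u hu v hv ur vr h (by omega)
      omega
    have := (ih (t.par u) v (by omega) c' e' hv vr (by rw [← a', huv]) (by omega)).2
    omega

open Classical in
noncomputable def fwd (ht : IsSLLS t) : ColTree k V where
  root := t.root
  par := fun v => if v ∈ V ∧ v ≠ t.root then t.par (ptop t v) else 0
  col := fun v => if v ∈ V ∧ v ≠ t.root then t.pos (ptop t v) else 0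
  root_mem := t.root_mem
  par_mem := by
    intro v hv hr
    have := ptop_spec' t ht v hv hr
    simp only [hv, hr, ne_eq, not_false_eq_true, and_self, if_true]
    exact t.par_mem _ this.1 this.2.1
  col_lt := by
    intro v hv hr
    have := ptop_spec' t ht v hv hr
    simp only [hv, hr, ne_eq, not_false_eq_true, and_self, if_true]
    exact this.2.2.1
  acyclic := by
    obtain ⟨d, hd⟩ := t.acyclic
    refine ⟨d, ?_⟩
    intro v hv hr
    have := ptop_spec t ht d hd v hv hr
    simp only [hv, hr, ne_eq, not_false_eq_true, and_self, if_true]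
    have := hd _ this.1 this.2.1
    omega
  par_default := by
    intro v hv
    have : ¬ (v ∈ V ∧ v ≠ t.root) := by tauto
    simp only [this, if_false]
  col_default := by
    intro v hv
    have : ¬ (v ∈ V ∧ v ≠ t.root) := by tauto
    simp only [this, if_false]

theorem fwd_par (ht : IsSLLS t) (v : ℕ) (hv : v ∈ V) (hr : v ≠ t.root) :
    (fwd t ht).par v = t.par (ptop t v) := if_pos ⟨hv, hr⟩

theorem fwd_col (ht : IsSLLS t) (v : ℕ) (hv : v ∈ V) (hr : v ≠ t.root) :
    (fwd t ht).col v = t.pos (ptop t v) := if_pos ⟨hv, hr⟩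

theorem fwd_root (ht : IsSLLS t) : (fwd t ht).root = t.root := rfl

theorem fwd_same (ht : IsSLLS t) (u v : ℕ) (hu : u ∈ V) (ur : u ≠ t.root) (hv : v ∈ V)
    (vr : v ≠ t.root) (h1 : (fwd t ht).par u = (fwd t ht).par v)
    (h2 : (fwd t ht).col u = (fwd t ht).col v) : ptop t u = ptop t v := by
  rw [fwd_par t ht u hu ur, fwd_par t ht v hv vr] at h1
  rw [fwd_col t ht u hu ur, fwd_col t ht v hv vr] at h2
  have a := ptop_spec' t ht u hu ur
  have b := ptop_spec' t ht v hv vr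
  exact t.plane _ a.1 _ b.1 a.2.1 b.2.1 h1 h2

theorem fwd_desc (ht : IsSLLS t) : ∀ x ∈ V, (∃ y, (fwd t ht).IsChild x y) →
    (fwd t ht).IsSDescent x := by
  classical
  rintro x hx ⟨y0, hy0⟩
  -- minimal colour
  have hC : ∃ c, ∃ y, (fwd t ht).IsChild x y ∧ (fwd t ht).col y = c := ⟨_, y0, hy0, rfl⟩
  have hL : ∃ y, (fwd t ht).IsChild x y ∧ (fwd t ht).col y = Nat.find hC := Nat.find_spec hC
  obtain ⟨hz, hzc⟩ := Nat.find_spec hL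
  have hzmin : ∀ w, (fwd t ht).IsChild x w → (fwd t ht).col w = Nat.find hC → Nat.find hL ≤ w :=
    fun w h1 h2 => Nat.find_min' hL ⟨h1, h2⟩
  have hcmin : ∀ w, (fwd t ht).IsChild x w → Nat.find hC ≤ (fwd t ht).col w :=
    fun w h1 => Nat.find_min' hC ⟨w, h1, rfl⟩
  generalize Nat.find hL = z at *
  generalize Nat.find hC = c at *
  refine ⟨z, hz, fun w hw => hzc ▸ hcmin w hw, fun w hw h => hzmin w hw (h.trans hzc), ?_⟩
  obtain ⟨z1, z2, z3⟩ := hz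
  rw [fwd_root] at z2
  rw [fwd_par t ht z z1 z2] at z3
  rw [fwd_col t ht z z1 z2] at hzc
  obtain ⟨s1, s2, s3, s4⟩ := ptop_spec' t ht z z1 z2
  have hi := ptop_idem_of t (ptop t z) (by omega)
  have hle := hzmin (ptop t z) ⟨s1, s2, by rw [fwd_par t ht _ s1 s2, hi, z3]⟩
    (by rw [fwd_col t ht _ s1 s2, hi, hzc])
  have he : ptop t z = z := le_antisymm s4 hle
  rw [he] at z3 hzc s3
  rw [← z3]
  refine ht.1.2 z z1 z2 s3 ?_
  intro w w1 w2 w3 w4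
  have w4' : t.pos w < k := w4
  have hw := ptop_idem_of t w (by omega)
  have := hcmin w ⟨w1, w2, by rw [fwd_par t ht _ w1 w2, hw, w3, z3]⟩
  rw [fwd_col t ht _ w1 w2, hw] at this
  omega

theorem back_fwd (ht : IsSLLS t) : back (fwd t ht) = t := by
  have key : ∀ v ∈ V, v ≠ t.root → bpar (fwd t ht) v = t.par v ∧ bpos (fwd t ht) v = t.pos v := by
    intro v hv hr
    by_cases h : t.pos v = k
    · obtain ⟨a, b, c, e⟩ := ptop_step t ht v hv hr h
      have p1 : (fwd t ht).par (t.par v) = (fwd t ht).par v := by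
        rw [fwd_par t ht _ c e, fwd_par t ht _ hv hr, a]
      have p2 : (fwd t ht).col (t.par v) = (fwd t ht).col v := by
        rw [fwd_col t ht _ c e, fwd_col t ht _ hv hr, a]
      rcases b_cases (fwd t ht) v hv hr with g | g
      · obtain ⟨g1, g2, g3, g4, g5, g6, g7⟩ := g
        have l1 := g7 (t.par v) c e p1 p2 b
        have l2 := (chain_lemma t ht _ _ v le_rfl g2 g3 hv hr
          (fwd_same t ht _ _ g2 g3 hv hr g4 g5) g6).2
        omega
      · have := g.2.2.2 (t.par v) c e p1 p2
        omega
    · have hi := ptop_idem_of t v h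
      rcases b_cases (fwd t ht) v hv hr with g | g
      · obtain ⟨g1, g2, g3, g4, g5, g6, g7⟩ := g
        have := (chain_lemma t ht _ _ v le_rfl g2 g3 hv hr
          (fwd_same t ht _ _ g2 g3 hv hr g4 g5) g6).1
        exact absurd this h
      · rw [g.2.2.1, g.2.1, fwd_par t ht _ hv hr, fwd_col t ht _ hv hr, hi]
        exact ⟨rfl, rfl⟩
  refine PlaneTree.eq_of _ _ rfl ?_ ?_
  · funext v
    by_cases h : v ∉ V ∨ v = t.root
    · rw [t.par_default v h]
      exact (back (fwd t ht)).par_default v h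
    · push Not at h
      exact (key v h.1 h.2).1
  · funext v
    by_cases h : v ∉ V ∨ v = t.root
    · rw [t.pos_default v h]
      exact (back (fwd t ht)).pos_default v h
    · push Not at h
      exact (key v h.1 h.2).2

end fwd

theorem fwd_back {k : ℕ} {V : Finset ℕ} (t : ColTree k V) (h : IsSLLS (back t)) :
    fwd (back t) h = t := by
  have key0 : ∀ v ∈ V, v ≠ t.root → t.par (ptop (back t) v) = t.par v ∧
      t.col (ptop (back t) v) = t.col v := by
    intro v
    induction v using Nat.strong_induction_on with
    | _ v ih =>
      intro hv hr
      rcases b_cases t v hv hr with g | g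
      · obtain ⟨g1, g2, g3, g4, g5, g6, g7⟩ := g
        have hs := (ptop_step (back t) h v hv hr g1).1
        change ptop (back t) v = ptop (back t) (bpar t v) at hs
        rw [hs, ← g4, ← g5]
        exact ih _ g6 g2 g3
      · rw [ptop_idem_of (back t) v (ne_of_lt g.1)]
        exact ⟨rfl, rfl⟩
  have key : ∀ v ∈ V, v ≠ t.root → (fwd (back t) h).par v = t.par v ∧
      (fwd (back t) h).col v = t.col v := by
    intro v hv hr
    rw [fwd_par (back t) h v hv hr, fwd_col (back t) h v hv hr]
    obtain ⟨a, b⟩ := key0 v hv hr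
    obtain ⟨s1, s2, s3, s4⟩ := ptop_spec' (back t) h v hv hr
    change bpos t _ < k at s3
    change bpar t _ = _ ∧ bpos t _ = _
    rcases b_cases t _ s1 s2 with g | g
    · omega
    · rw [g.2.2.1, g.2.1]
      exact ⟨a, b⟩
  refine ColTree.eq_of _ _ rfl ?_ ?_
  · funext v
    by_cases hh : v ∉ V ∨ v = t.root
    · rw [t.par_default v hh]
      exact (fwd (back t) h).par_default v hh
    · push Not at hh
      exact (key v hh.1 hh.2).1
  · funext v
    by_cases hh : v ∉ V ∨ v = t.root
    · rw [t.col_default v hh]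
      exact (fwd (back t) h).col_default v hh
    · push Not at hh
      exact (key v hh.1 hh.2).2

end Aux

/-- For every `n ≥ 1` and every integer `k ≥ 1`, the number of `SLL_{k+1}S` on `[n]`
equals the number of `k`-coloured rooted labelled trees on `[n]` in which every
inner vertex is an S-descent. -/
theorem sllks_card_eq_sdescent_trees (n : ℕ) (hn : 1 ≤ n) (k : ℕ) (hk : 1 ≤ k) :
    Nat.card {t : PlaneTree (k + 1) (Finset.Icc 1 n) // IsSLLS t} =
      Nat.card {t : ColTree k (Finset.Icc 1 n) //
        ∀ x ∈ Finset.Icc 1 n, (∃ y, t.IsChild x y) → t.IsSDescent x} := by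
  exact Nat.card_congr
    { toFun := fun p => ⟨fwd p.1 p.2, fwd_desc p.1 p.2⟩
      invFun := fun c => ⟨back c.1, back_slls c.1 c.2⟩
      left_inv := fun p => Subtype.ext (back_fwd p.1 p.2)
      right_inv := fun c => Subtype.ext (fwd_back c.1 (back_slls c.1 c.2)) }
end
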